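/- Let a < b, c < d, and let φ : ℝ × ℝ → ℝ be integrable on [a, b] × [c, d]. Assume that for almost every x ∈ [a, b], the function y ↦ φ(x, y) is countably piecewise monotonic on [c, d): there exist countably many pairwise disjoint intervals [cₙ, dₙ) covering [c, d) on whose interiors y ↦ φ(x, y) is monotone, twice continuously differentiable with bounded function and first two derivatives, and the set {y : ∂φ/∂y(x, y) = 0} is countable. Let f : ℝ × ℝ → ℂ be Lebesgue integrable on [a, b] × [c, d]. Then the double integral ∫ₐᵇ ∫꜀ᵈ f(x, y) e^{i φ(x, y) t} dy dx tends to 0 as t → ∞. -/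

import Mathlib

open MeasureTheory Filter

/-- A function `φ` is countably piecewise monotone on `[c, d)` with `C²_B` pieces:
`[c, d)` decomposes into countably many pairwise disjoint intervals `[cN n, dN n)`,
and on the interior of each piece `φ` is monotone, twice continuously differentiable
with `φ`, `φ'`, `φ''` bounded, and has a countable critical set. -/
def PiecewiseMonotoneC2B (φ : ℝ → ℝ) (c d : ℝ) : Prop :=
  ∃ cN dN : ℕ → ℝ,
    (⋃ n, Set.Ico (cN n) (dN n)) = Set.Ico c d ∧
    (Pairwise fun n m => Disjoint (Set.Ico (cN n) (dN n)) (Set.Ico (cN m) (dN m))) ∧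
    ∀ n, (MonotoneOn φ (Set.Ioo (cN n) (dN n)) ∨ AntitoneOn φ (Set.Ioo (cN n) (dN n))) ∧
      ContDiffOn ℝ 2 φ (Set.Ioo (cN n) (dN n)) ∧
      (∃ M : ℝ, ∀ y ∈ Set.Ioo (cN n) (dN n),
        |φ y| ≤ M ∧ |deriv φ y| ≤ M ∧ |deriv (deriv φ) y| ≤ M) ∧
      ({y ∈ Set.Ioo (cN n) (dN n) | deriv φ y = 0}).Countable

lemma rl_aux (G : ℝ → ℂ) :
    Tendsto (fun t : ℝ => ∫ u, G u * Complex.exp (Complex.I * u * t)) atTop (nhds 0) := by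
  have h := Real.tendsto_integral_exp_smul_cocompact (E := ℂ) G
  have h2 : Tendsto (fun t : ℝ => -(t / (2 * Real.pi))) atTop (cocompact ℝ) := by
    have : Tendsto (fun t : ℝ => -(t / (2 * Real.pi))) atTop atBot :=
      tendsto_neg_atTop_atBot.comp (tendsto_id.atTop_div_const (by positivity))
    exact this.mono_right atBot_le_cocompact
  refine (h.comp h2).congr fun t => ?_
  simp only [Function.comp]
  refine integral_congr_ae (Eventually.of_forall fun u => ?_)
  simp only [Circle.smul_def, Real.fourierChar_apply, smul_eq_mul]
  rw [mul_comm]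
  congr 2
  have : (Real.pi : ℂ) ≠ 0 := by exact_mod_cast Real.pi_ne_zero
  push_cast
  field_simp

lemma piece_aux (s : Set ℝ) (hs : MeasurableSet s) (ψ : ℝ → ℝ)
    (hd : ∀ y ∈ s, DifferentiableAt ℝ ψ y) (h0 : ∀ y ∈ s, deriv ψ y ≠ 0)
    (hinj : Set.InjOn ψ s) (g : ℝ → ℂ) :
    Tendsto (fun t : ℝ => ∫ y in s, g y * Complex.exp (Complex.I * ψ y * t)) atTop (nhds 0) := by
  set r := Function.invFunOn ψ s
  have hmi : MeasurableSet (ψ '' s) :=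
    MeasureTheory.measurable_image_of_fderivWithin hs
      (fun y hy => ((hd y hy).hasDerivAt.hasDerivWithinAt.hasFDerivWithinAt)) hinj
  have h := rl_aux ((ψ '' s).indicator fun u => g (r u) / (|deriv ψ (r u)| : ℝ))
  refine h.congr fun t => ?_
  have e : (fun u : ℝ => (ψ '' s).indicator (fun u => g (r u) / (|deriv ψ (r u)| : ℝ)) u
      * Complex.exp (Complex.I * u * t)) = (ψ '' s).indicator (fun u =>
        (g (r u) / (|deriv ψ (r u)| : ℝ)) * Complex.exp (Complex.I * u * t)) := by
    funext u
    by_cases hu : u ∈ ψ '' s <;> simp [hu]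
  rw [e, integral_indicator hmi, integral_image_eq_integral_abs_deriv_smul hs
    (fun y hy => (hd y hy).hasDerivAt.hasDerivWithinAt) hinj]
  refine setIntegral_congr_fun hs fun y hy => ?_
  have hr : r (ψ y) = y := hinj.leftInvOn_invFunOn hy
  have hne : ((|deriv ψ y| : ℝ) : ℂ) ≠ 0 := by
    exact_mod_cast abs_ne_zero.2 (h0 y hy)
  simp only [hr, Complex.real_smul]
  field_simp

lemma inj_aux (p q : ℝ) (ψ : ℝ → ℝ)
    (hm : MonotoneOn ψ (Set.Ioo p q) ∨ AntitoneOn ψ (Set.Ioo p q))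
    (hc : ({y ∈ Set.Ioo p q | deriv ψ y = 0}).Countable) : Set.InjOn ψ (Set.Ioo p q) := by
  have key : ∀ x ∈ Set.Ioo p q, ∀ y ∈ Set.Ioo p q, x < y → ψ x ≠ ψ y := by
    intro x hx y hy hxy he
    have hconst : ∀ z ∈ Set.Ioo x y, ψ z = ψ x := by
      intro z hz
      have hz' : z ∈ Set.Ioo p q := ⟨hx.1.trans hz.1, hz.2.trans hy.2⟩
      rcases hm with hm | hm
      · exact le_antisymm ((hm hz' hy hz.2.le).trans he.ge) (hm hx hz' hz.1.le)
      · exact le_antisymm (hm hx hz' hz.1.le) (he.le.trans (hm hz' hy hz.2.le))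
    have hsub : Set.Ioo x y ⊆ {y ∈ Set.Ioo p q | deriv ψ y = 0} := by
      intro z hz
      refine ⟨⟨hx.1.trans hz.1, hz.2.trans hy.2⟩, ?_⟩
      have : ψ =ᶠ[nhds z] fun _ => ψ x := by
        filter_upwards [isOpen_Ioo.mem_nhds hz] with w hw using hconst w hw
      rw [this.deriv_eq]; simp
    have h0 := (hc.mono hsub).measure_zero volume
    rw [Real.volume_Ioo, ENNReal.ofReal_eq_zero] at h0
    linarith
  intro x hx y hy he
  rcases lt_trichotomy x y with h | h | h
  · exact (key x hx y hy h he).elim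
  · exact h
  · exact (key y hy x hx h he.symm).elim

lemma norm_aux (z : ℂ) (u t : ℝ) : ‖z * Complex.exp (Complex.I * u * t)‖ = ‖z‖ := by
  rw [norm_mul, show Complex.I * (u : ℂ) * t = ((u * t : ℝ) : ℂ) * Complex.I by push_cast; ring,
    Complex.norm_exp_ofReal_mul_I, mul_one]

lemma inner_aux (c d : ℝ) (ψ : ℝ → ℝ) (h : PiecewiseMonotoneC2B ψ c d)
    (hψ : AEStronglyMeasurable ψ (volume.restrict (Set.Ico c d)))
    (g : ℝ → ℂ) (hg : IntegrableOn g (Set.Ico c d)) :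
    Tendsto (fun t : ℝ => ∫ y in Set.Ico c d, g y * Complex.exp (Complex.I * ψ y * t))
      atTop (nhds 0) := by
  obtain ⟨cN, dN, hU, hdis, hp⟩ := h
  have hInt : ∀ t : ℝ, IntegrableOn (fun y => g y * Complex.exp (Complex.I * ψ y * t))
      (Set.Ico c d) := by
    intro t
    refine Integrable.mono hg (hg.aestronglyMeasurable.mul ?_)
      (Eventually.of_forall fun y => (norm_aux _ _ _).le)
    exact (show Continuous fun u : ℝ => Complex.exp (Complex.I * u * t) by
      fun_prop).comp_aestronglyMeasurable hψ
  rw [← hU] at hInt hg ⊢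
  have hmeas : ∀ n, MeasurableSet (Set.Ico (cN n) (dN n)) := fun n => measurableSet_Ico
  have hsum : Summable fun n => ∫ y in Set.Ico (cN n) (dN n), ‖g y‖ :=
    (hasSum_integral_iUnion hmeas hdis hg.norm).summable
  have hrew : ∀ t : ℝ, ∑' n, ∫ y in Set.Ico (cN n) (dN n),
      g y * Complex.exp (Complex.I * ψ y * t) =
      ∫ y in ⋃ n, Set.Ico (cN n) (dN n), g y * Complex.exp (Complex.I * ψ y * t) :=
    fun t => (hasSum_integral_iUnion hmeas hdis (hInt t)).tsum_eq
  have := tendsto_tsum_of_dominated_convergence (𝓕 := atTop)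
    (f := fun (t : ℝ) n => ∫ y in Set.Ico (cN n) (dN n),
      g y * Complex.exp (Complex.I * ψ y * t)) (g := fun _ => 0) hsum ?_ ?_
  · rw [tsum_zero] at this
    exact this.congr hrew
  · intro n
    obtain ⟨hm, hcd, -, hcrit⟩ := hp n
    set Z := {y ∈ Set.Ioo (cN n) (dN n) | deriv ψ y = 0} with hZ
    have hae : (Set.Ico (cN n) (dN n) : Set ℝ) =ᵐ[volume]
        (Set.Ioo (cN n) (dN n) \ Z : Set ℝ) :=
      Ioo_ae_eq_Ico.symm.trans
        (sdiff_null_ae_eq_self (hcrit.measure_zero volume)).symm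
    simp only [setIntegral_congr_set hae]
    refine piece_aux _ (measurableSet_Ioo.diff hcrit.measurableSet) ψ ?_ ?_ ?_ g
    · intro y hy
      exact (hcd.differentiableOn (by norm_num)).differentiableAt (isOpen_Ioo.mem_nhds hy.1)
    · intro y hy h0
      exact hy.2 ⟨hy.1, h0⟩
    · exact (inj_aux _ _ ψ hm hcrit).mono Set.sdiff_subset
  · refine Eventually.of_forall fun t n => ?_
    refine (norm_integral_le_integral_norm _).trans (le_of_eq ?_)
    simp only [norm_aux]

theorem two_dim_oscillatory_integral_tendsto_zero
    (a b c d : ℝ) (hab : a < b) (hcd : c < d) (φ : ℝ × ℝ → ℝ)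
    (hφint : IntegrableOn φ (Set.Icc a b ×ˢ Set.Icc c d))
    (hφ : ∀ᵐ x ∂(volume.restrict (Set.Icc a b)),
      PiecewiseMonotoneC2B (fun y => φ (x, y)) c d)
    (f : ℝ × ℝ → ℂ) (hf : IntegrableOn f (Set.Icc a b ×ˢ Set.Icc c d)) :
    Tendsto
      (fun t : ℝ => ∫ x in a..b, ∫ y in c..d,
        f (x, y) * Complex.exp (Complex.I * φ (x, y) * t))
      atTop (nhds 0) := by
  have hIco : (volume.restrict (Set.Icc c d) : Measure ℝ) = volume.restrict (Set.Ico c d) :=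
    Measure.restrict_congr_set Ico_ae_eq_Icc.symm
  rw [IntegrableOn, Measure.volume_eq_prod, ← Measure.prod_restrict, hIco] at hf hφint
  have hInt : ∀ t : ℝ, Integrable (fun p : ℝ × ℝ => f p * Complex.exp (Complex.I * φ p * t))
      ((volume.restrict (Set.Icc a b)).prod (volume.restrict (Set.Ico c d))) := by
    intro t
    refine hf.mono (hf.aestronglyMeasurable.mul ?_)
      (Eventually.of_forall fun y => (norm_aux _ _ _).le)
    exact (show Continuous fun u : ℝ => Complex.exp (Complex.I * u * t) by
      fun_prop).comp_aestronglyMeasurable hφint.aestronglyMeasurable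
  have hrew : ∀ t : ℝ, (∫ x in a..b, ∫ y in c..d,
        f (x, y) * Complex.exp (Complex.I * φ (x, y) * t)) =
      ∫ x in Set.Icc a b, ∫ y in Set.Ico c d,
        f (x, y) * Complex.exp (Complex.I * φ (x, y) * t) := by
    intro t
    simp only [intervalIntegral.integral_of_le hab.le, intervalIntegral.integral_of_le hcd.le,
      ← integral_Icc_eq_integral_Ioc, hIco]
  simp only [hrew]
  rw [← integral_zero ℝ ℂ (μ := volume.restrict (Set.Icc a b))]
  refine tendsto_integral_filter_of_dominated_convergence
    (fun x => ∫ y in Set.Ico c d, ‖f (x, y)‖) ?_ ?_ hf.norm.integral_prod_left ?_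
  · exact Eventually.of_forall fun t => (hInt t).integral_prod_left.aestronglyMeasurable
  · refine Eventually.of_forall fun t => Eventually.of_forall fun x => ?_
    refine (norm_integral_le_integral_norm _).trans (le_of_eq ?_)
    simp only [norm_aux]
  · filter_upwards [hφ, hf.prod_right_ae, hφint.prod_right_ae] with x h1 h2 h3
    exact inner_aux c d (fun y => φ (x, y)) h1 h3.aestronglyMeasurable (fun y => f (x, y)) h2
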